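/- Let E be a locally compact Polish space, Q a transition function satisfying the standing hypotheses (H), and α ∈ (0,1). For each n ∈ ℕ take a partition 0 = t₀⁽ⁿ⁾ < t₁⁽ⁿ⁾ < t₂⁽ⁿ⁾ < … with t_k⁽ⁿ⁾ → ∞ as k → ∞ and mesh sup_{k≥0}(t_{k+1}⁽ⁿ⁾ − t_k⁽ⁿ⁾) → 0 as n → ∞, and define the piecewise constant transition functions Q_n(t,x,dy) := Q(t_k⁽ⁿ⁾,x,dy) for t_k⁽ⁿ⁾ ≤ t < t_{k+1}⁽ⁿ⁾. Let U_{α,n} be the α-regularized evolution built from Q_n and T_{α,r} the α-regularized semigroup built from the time-homogeneous transition function Q^r(x,dy) := Q(r,x,dy). Then for every bounded continuous F and 0 ≤ s ≤ t, choosing m₀, m₁ with t_{m₀}⁽ⁿ⁾ ≤ s < t_{m₀+1}⁽ⁿ⁾ ≤ … ≤ t_{m₁}⁽ⁿ⁾ ≤ t < t_{m₁+1}⁽ⁿ⁾, one has U_{α,n}(s,t)F = T_{α,t_{m₀}⁽ⁿ⁾}(t_{m₀+1}⁽ⁿ⁾ − s) ⋯ T_{α,t_{m₁}⁽ⁿ⁾}(t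 − t_{m₁}⁽ⁿ⁾) F, and U_{α,n}(s,t)F → U_α(s,t)F as n → ∞ uniformly on every compact subset of E. -/

import Mathlib

open MeasureTheory Set

variable {E : Type*}

/-- The cumulative intensity `q(t,x) = Q(t,x,E)`. -/
noncomputable def qIntensity [MeasurableSpace E] (Q : ℝ → E → Measure E) (t : ℝ) (x : E) : ℝ :=
  (Q t x univ).toReal

/-- The iterated kernels `P⁽ⁿ⁾(s,x;t,·)`. -/
noncomputable def Piter [MeasurableSpace E] (Q : ℝ → E → Measure E) :
    ℕ → ℝ → ℝ → E → Measure E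
  | 0, s, t, x =>
      ENNReal.ofReal (Real.exp (-∫ r in s..t, qIntensity Q r x)) • Measure.dirac x
  | n + 1, s, t, x =>
      Measure.bind
        ((volume.restrict (Ioc s t)).withDensity fun r =>
          ENNReal.ofReal (Real.exp (-∫ τ in s..r, qIntensity Q τ x)))
        fun r => Measure.bind (Q r x) fun y => Piter Q n r t y

/-- The minimal transition function `P(s,x;t,·) = Σ_n P⁽ⁿ⁾(s,x;t,·)`. -/
noncomputable def Pmin [MeasurableSpace E] (Q : ℝ → E → Measure E) (s t : ℝ) (x : E) :
    Measure E :=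
  Measure.sum fun n => Piter Q n s t x

/-- The evolution system `U(s,t)F(x) = ∫_E F(y) P(s,x;t,dy)`. -/
noncomputable def Umin [MeasurableSpace E] (Q : ℝ → E → Measure E) (s t : ℝ) (F : E → ℝ)
    (x : E) : ℝ :=
  ∫ y, F y ∂(Pmin Q s t x)

/-- `Q` is a transition function. -/
def IsTransitionFunction [MeasurableSpace E] [TopologicalSpace E]
    (Q : ℝ → E → Measure E) : Prop :=
  (∀ t x, 0 ≤ t → IsFiniteMeasure (Q t x)) ∧
  (∀ t x, 0 ≤ t → Q t x {x} = 0) ∧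
  (∀ A : Set E, MeasurableSet A → Measurable fun p : ℝ × E => Q p.1 p.2 A) ∧
  (∀ T > (0 : ℝ), ∀ B : Set E, IsCompact B →
    ∃ C : ℝ, ∀ t ∈ Icc (0 : ℝ) T, ∀ x ∈ B, (Q t x univ).toReal ≤ C)

/-- The standing hypotheses (H). -/
structure StandingHypotheses [MeasurableSpace E] [TopologicalSpace E]
    (Q : ℝ → E → Measure E) (V : E → ℝ) (c : ℝ → ℝ) : Prop where
  V_cont : Continuous V
  V_nonneg : ∀ x, 0 ≤ V x
  c_cont : Continuous c
  c_nonneg : ∀ t, 0 ≤ c t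
  weak_cont : ∀ F : E → ℝ, Continuous F → (∃ M : ℝ, ∀ x, |F x| ≤ M * (1 + V x)) →
    ContinuousOn (fun p : ℝ × E => ∫ y, F y ∂(Q p.1 p.2)) {p : ℝ × E | 0 ≤ p.1}
  q_bound : ∀ T > (0 : ℝ), ∃ a > (0 : ℝ), ∀ t ∈ Icc (0 : ℝ) T, ∀ x,
    qIntensity Q t x ≤ a * V x
  lyapunov : ∀ t : ℝ, 0 ≤ t → ∀ x,
    ∫⁻ y, ENNReal.ofReal (V y) ∂(Q t x)
      ≤ ENNReal.ofReal (c t * V x + qIntensity Q t x * V x)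
  localization : ∀ ε > (0 : ℝ), ∀ B : Set E, IsCompact B → ∀ T > (0 : ℝ),
    ∃ A : Set E, IsCompact A ∧ ∀ x ∈ B, ∫ r in (0 : ℝ)..T, (Q r x Aᶜ).toReal < ε

/-- The α-regularized evolution `U_α(s,t)F(x) = Σ_n αⁿ ∫_E F(y) P⁽ⁿ⁾(s,x;t,dy)`. -/
noncomputable def Ualpha [MeasurableSpace E] (Q : ℝ → E → Measure E) (α : ℝ)
    (s t : ℝ) (F : E → ℝ) (x : E) : ℝ :=
  ∑' n : ℕ, α ^ n * ∫ y, F y ∂(Piter Q n s t x)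

/-- The α-regularized semigroup `T_{α,r}(u)` built from the time-homogeneous transition
function `Q^r(x,dy) := Q(r,x,dy)`. -/
noncomputable def Talpha [MeasurableSpace E] (Q : ℝ → E → Measure E) (α : ℝ)
    (r u : ℝ) (F : E → ℝ) (x : E) : ℝ :=
  Ualpha (fun _ x' => Q r x') α 0 u F x

open Filter Topology ENNReal

/-- A jointly measurable family of measures whose total mass is bounded uniformly in time
by a function of the state. -/
structure IsBoundedRate [MeasurableSpace E] (Q : ℝ → E → Measure E) (W : E → ℝ) : Prop where
  measurable : Measurable fun p : ℝ × E => Q p.1 p.2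
  le : ∀ t x, Q t x univ ≤ ENNReal.ofReal (W x)

/-- The probability `exp (-∫_s^r q(τ,x) dτ)` of not jumping out of `x` during `[s,r]`. -/
noncomputable def survival [MeasurableSpace E] (Q : ℝ → E → Measure E) (x : E) (s r : ℝ) : ℝ :=
  Real.exp (-∫ τ in s..r, qIntensity Q τ x)

lemma survival_pos [MeasurableSpace E] (Q : ℝ → E → Measure E) (x : E) (s r : ℝ) :
    0 < survival Q x s r := Real.exp_pos _

lemma qIntensity_nonneg [MeasurableSpace E] (Q : ℝ → E → Measure E) (t : ℝ) (x : E) :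
    0 ≤ qIntensity Q t x := ENNReal.toReal_nonneg

lemma survival_le_one [MeasurableSpace E] (Q : ℝ → E → Measure E) (x : E) {s r : ℝ}
    (h : s ≤ r) : survival Q x s r ≤ 1 := by
  unfold survival
  rw [Real.exp_le_one_iff, neg_nonpos]
  exact intervalIntegral.integral_nonneg h fun τ _ => qIntensity_nonneg Q τ x

/-- A measurable family of finite measures is a measurable multiple of a finite kernel. -/
lemma exists_isFiniteKernel_eq_smul {A B : Type*} [MeasurableSpace A] [MeasurableSpace B]
    {κ : A → Measure B} (hκ : Measurable κ) (hfin : ∀ a, IsFiniteMeasure (κ a)) :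
    ∃ (η : ProbabilityTheory.Kernel A B) (c : A → ℝ≥0∞), ProbabilityTheory.IsFiniteKernel η ∧
      Measurable c ∧ ∀ a, κ a = c a • η a := by
  have hm : Measurable fun a => 1 + κ a univ :=
    measurable_const.add ((Measure.measurable_coe MeasurableSet.univ).comp hκ)
  let η : ProbabilityTheory.Kernel A B :=
    ⟨fun a => (1 + κ a univ)⁻¹ • κ a, Measure.measurable_of_measurable_coe _ fun s hs => by
      simp only [Measure.smul_apply, smul_eq_mul]
      exact hm.inv.mul ((Measure.measurable_coe hs).comp hκ)⟩
  refine ⟨η, fun a => 1 + κ a univ, ⟨1, one_lt_top, fun a => ?_⟩, hm, fun a => ?_⟩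
  · change (1 + κ a univ)⁻¹ * κ a univ ≤ 1
    rw [mul_comm, ← div_eq_mul_inv]
    exact ENNReal.div_le_of_le_mul (by rw [one_mul]; exact le_add_self)
  · change κ a = (1 + κ a univ) • (1 + κ a univ)⁻¹ • κ a
    rw [smul_smul, ENNReal.mul_inv_cancel (by simp) (by simp), one_smul]

/-- If `κ` is a measurable family of finite measures, then `∫⁻ f(a, y) κ(a, dy)` depends
measurably on `a`. -/
lemma measurable_lintegral_of_isFiniteMeasure {A B : Type*} [MeasurableSpace A]
    [MeasurableSpace B] {κ : A → Measure B} (hκ : Measurable κ)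
    (hfin : ∀ a, IsFiniteMeasure (κ a)) {f : A × B → ℝ≥0∞} (hf : Measurable f) :
    Measurable fun a => ∫⁻ b, f (a, b) ∂κ a := by
  obtain ⟨η, c, _, hc, h⟩ := exists_isFiniteKernel_eq_smul hκ hfin
  simp only [h, lintegral_smul_measure, smul_eq_mul]
  have hη : Measurable fun a => ∫⁻ b, f (a, b) ∂η a := hf.lintegral_kernel_prod_right'
  exact hc.mul hη

/-- If `κ` is a measurable family of finite measures, then `∫ f(a, y) κ(a, dy)` depends
measurably on `a`. -/
lemma measurable_integral_of_isFiniteMeasure {A B : Type*} [MeasurableSpace A]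
    [MeasurableSpace B] {κ : A → Measure B} (hκ : Measurable κ)
    (hfin : ∀ a, IsFiniteMeasure (κ a)) {f : A × B → ℝ} (hf : Measurable f) :
    Measurable fun a => ∫ b, f (a, b) ∂κ a := by
  obtain ⟨η, c, _, hc, h⟩ := exists_isFiniteKernel_eq_smul hκ hfin
  simp only [h, integral_smul_measure, smul_eq_mul]
  exact hc.ennreal_toReal.mul
    (hf.stronglyMeasurable.integral_kernel_prod_right' (κ := η)).measurable

/-- Fubini for the Giry bind and bounded real functions. -/
lemma integral_bind_of_bounded {A B : Type*} [MeasurableSpace A] [MeasurableSpace B]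
    {μ : Measure A} {κ : A → Measure B} (hκ : AEMeasurable κ μ)
    (hfin : IsFiniteMeasure (μ.bind κ)) {f : B → ℝ} (hf : Measurable f) {M : ℝ}
    (hM : ∀ b, |f b| ≤ M) :
    ∫ b, f b ∂(μ.bind κ) = ∫ a, ∫ b, f b ∂κ a ∂μ := by
  have hmass : ∫⁻ a, κ a univ ∂μ = μ.bind κ univ := (Measure.bind_apply .univ hκ).symm
  have hmm : AEMeasurable (fun a => κ a univ) μ :=
    (Measure.measurable_coe MeasurableSet.univ).comp_aemeasurable hκ
  have hae : ∀ᵐ a ∂μ, IsFiniteMeasure (κ a) := by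
    filter_upwards [ae_lt_top' hmm (hmass ▸ measure_ne_top _ _)] with a ha using ⟨ha⟩
  have key : ∀ g : B → ℝ, Measurable g → (∀ b, 0 ≤ g b) → (∃ C, ∀ b, g b ≤ C) →
      ∫ b, g b ∂(μ.bind κ) = ∫ a, ∫ b, g b ∂κ a ∂μ ∧
        Integrable (fun a => ∫ b, g b ∂κ a) μ := by
    rintro g hg h0 ⟨C, hC⟩
    have e1 : ∀ ν : Measure B, ∫ b, g b ∂ν = (∫⁻ b, ENNReal.ofReal (g b) ∂ν).toReal := fun ν =>
      integral_eq_lintegral_of_nonneg_ae (.of_forall h0) hg.aestronglyMeasurable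
    have m1 : AEMeasurable (fun a => ∫⁻ b, ENNReal.ofReal (g b) ∂κ a) μ :=
      (Measure.measurable_lintegral hg.ennreal_ofReal).comp_aemeasurable hκ
    have l1 : ∫⁻ b, ENNReal.ofReal (g b) ∂(μ.bind κ) =
        ∫⁻ a, ∫⁻ b, ENNReal.ofReal (g b) ∂κ a ∂μ :=
      Measure.lintegral_bind hκ hg.ennreal_ofReal.aemeasurable
    have f1 : ∫⁻ b, ENNReal.ofReal (g b) ∂(μ.bind κ) ≠ ∞ := by
      refine ne_top_of_le_ne_top ?_ (lintegral_mono fun b => ENNReal.ofReal_le_ofReal (hC b))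
      rw [lintegral_const]
      exact ENNReal.mul_ne_top ENNReal.ofReal_ne_top (measure_ne_top _ _)
    rw [l1] at f1
    have i1 := integrable_toReal_of_lintegral_ne_top m1 f1
    simp only [← e1] at i1
    refine ⟨?_, i1⟩
    rw [e1, l1, ← integral_toReal m1 (ae_lt_top' m1 f1)]
    simp only [← e1]
  have int1 : ∀ ν : Measure B, IsFiniteMeasure ν → Integrable f ν := fun ν _ =>
    Integrable.of_bound hf.aestronglyMeasurable M (.of_forall hM)
  have hM' : ∀ b, 0 ≤ f b + |M| := fun b => by
    have := neg_abs_le (f b)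
    have := le_abs_self M
    linarith [hM b]
  obtain ⟨k1, k2⟩ := key (fun b => f b + |M|) (hf.add_const _) hM'
    ⟨M + |M|, fun b => by linarith [hM b, le_abs_self (f b)]⟩
  obtain ⟨k3, k4⟩ := key (fun _ => |M|) measurable_const (fun _ => abs_nonneg _)
    ⟨|M|, fun _ => le_rfl⟩
  rw [integral_add (int1 _ hfin) (integrable_const _), k3] at k1
  have : ∫ a, ∫ b, f b + |M| ∂κ a ∂μ =
      ∫ a, ((∫ b, f b + |M| ∂κ a) - ∫ _, |M| ∂κ a) ∂μ + ∫ a, ∫ _, |M| ∂κ a ∂μ := by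
    rw [integral_sub k2 k4]; ring
  rw [add_right_cancel (k1.trans this)]
  refine integral_congr_ae ?_
  filter_upwards [hae] with a ha
  rw [integral_add (int1 _ ha) (integrable_const _)]
  ring

namespace IsBoundedRate

variable [MeasurableSpace E] {Q : ℝ → E → Measure E} {W : E → ℝ}

lemma isFiniteMeasure (h : IsBoundedRate Q W) (t : ℝ) (x : E) : IsFiniteMeasure (Q t x) :=
  ⟨(h.le t x).trans_lt ENNReal.ofReal_lt_top⟩

lemma qIntensity_le (h : IsBoundedRate Q W) (t : ℝ) (x : E) : qIntensity Q t x ≤ |W x| :=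
  ENNReal.toReal_le_of_le_ofReal (abs_nonneg _)
    ((h.le t x).trans (ENNReal.ofReal_le_ofReal (le_abs_self _)))

lemma measurable_qIntensity (h : IsBoundedRate Q W) :
    Measurable fun p : ℝ × E => qIntensity Q p.1 p.2 :=
  ((Measure.measurable_coe MeasurableSet.univ).comp h.measurable).ennreal_toReal

lemma measurable_qIntensity_left (h : IsBoundedRate Q W) (x : E) :
    Measurable fun t => qIntensity Q t x :=
  h.measurable_qIntensity.comp measurable_prodMk_right

lemma intervalIntegrable (h : IsBoundedRate Q W) (x : E) (a b : ℝ) :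
    IntervalIntegrable (fun t => qIntensity Q t x) volume a b := by
  refine (intervalIntegrable_const (c := |W x|)).mono_fun'
    (h.measurable_qIntensity_left x).aestronglyMeasurable (.of_forall fun t => ?_)
  dsimp only
  rw [Real.norm_of_nonneg (qIntensity_nonneg _ _ _)]
  exact h.qIntensity_le t x

lemma survival_mul (h : IsBoundedRate Q W) (x : E) (s r t : ℝ) :
    survival Q x s r * survival Q x r t = survival Q x s t := by
  unfold survival
  rw [← Real.exp_add, ← neg_add, intervalIntegral.integral_add_adjacent_intervals
    (h.intervalIntegrable x s r) (h.intervalIntegrable x r t)]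

lemma measurable_survival (h : IsBoundedRate Q W) :
    Measurable fun p : (ℝ × E) × ℝ => survival Q p.1.2 p.1.1 p.2 := by
  have aux : ∀ a b : (ℝ × E) × ℝ → ℝ, Measurable a → Measurable b →
      Measurable fun p : (ℝ × E) × ℝ => ∫ τ in Ioc (a p) (b p), qIntensity Q τ p.1.2 := by
    intro a b ha hb
    have hS : MeasurableSet {z : ((ℝ × E) × ℝ) × ℝ | a z.1 < z.2 ∧ z.2 ≤ b z.1} :=
      (measurableSet_lt (ha.comp measurable_fst) measurable_snd).inter
        (measurableSet_le measurable_snd (hb.comp measurable_fst))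
    have hq : Measurable fun z : ((ℝ × E) × ℝ) × ℝ => qIntensity Q z.2 z.1.1.2 :=
      h.measurable_qIntensity.comp (by fun_prop : Measurable
        fun z : ((ℝ × E) × ℝ) × ℝ => (z.2, z.1.1.2))
    have := (hq.indicator hS).stronglyMeasurable.integral_prod_right' (ν := volume)
    convert this.measurable using 2 with p
    rw [← integral_indicator measurableSet_Ioc]
    rfl
  unfold survival intervalIntegral
  exact Real.measurable_exp.comp
    ((aux _ _ (by fun_prop) (by fun_prop)).sub (aux _ _ (by fun_prop) (by fun_prop))).neg

lemma measurable_survival_right (h : IsBoundedRate Q W) (x : E) (s : ℝ) :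
    Measurable (survival Q x s) :=
  h.measurable_survival.comp (measurable_prodMk_left (x := ((s, x) : ℝ × E)))

lemma integral_survival_mul_le_one (h : IsBoundedRate Q W) (x : E) {s t : ℝ} (hst : s ≤ t) :
    ∫ r in s..t, survival Q x s r * qIntensity Q r x ≤ 1 := by
  have hL : ∀ a b : ℝ, |∫ τ in a..b, qIntensity Q τ x| ≤ |W x| * |b - a| := fun a b =>
    intervalIntegral.norm_integral_le_of_norm_le_const (f := fun τ => qIntensity Q τ x)
      fun τ _ => by
      rw [Real.norm_of_nonneg (qIntensity_nonneg _ _ _)]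
      exact h.qIntensity_le τ x
  have hac : AbsolutelyContinuousOnInterval (survival Q x s) s t := by
    refine LipschitzOnWith.absolutelyContinuousOnInterval (K := (|W x|).toNNReal) ?_
    refine LipschitzOnWith.of_dist_le_mul fun a ha b hb => ?_
    rw [Real.coe_toNNReal _ (abs_nonneg _)]
    wlog hab : a ≤ b generalizing a b
    · rw [dist_comm, dist_comm a]
      exact this b hb a ha (le_of_not_ge hab)
    rw [uIcc_of_le hst] at ha
    rw [dist_comm, dist_comm a, Real.dist_eq, Real.dist_eq, abs_sub_comm,
      ← h.survival_mul x s a b, ← mul_one_sub, abs_mul, abs_of_pos (survival_pos _ _ _ _),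
      abs_of_nonneg (sub_nonneg.2 (survival_le_one Q x hab))]
    have h1 : 1 - survival Q x a b ≤ |W x| * |b - a| := by
      refine le_trans ?_ (hL a b)
      have := Real.add_one_le_exp (-∫ τ in a..b, qIntensity Q τ x)
      unfold survival
      linarith [le_abs_self (∫ τ in a..b, qIntensity Q τ x)]
    calc _ ≤ 1 * (1 - survival Q x a b) := by
          gcongr
          · exact sub_nonneg.2 (survival_le_one Q x hab)
          · exact survival_le_one Q x ha.1
      _ ≤ _ := by rwa [one_mul]
  have hint := hac.integral_deriv_eq_sub
  have hder : ∫ r in s..t, survival Q x s r * qIntensity Q r x =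
      -∫ r in s..t, deriv (survival Q x s) r := by
    rw [← intervalIntegral.integral_neg]
    refine intervalIntegral.integral_congr_ae ?_
    filter_upwards [(h.intervalIntegrable x s t).ae_hasDerivAt_integral] with r hr hrm
    have := ((hr (uIoc_subset_uIcc hrm) s left_mem_uIcc).neg.exp).deriv
    change deriv (survival Q x s) r = survival Q x s r * -qIntensity Q r x at this
    rw [this]
    ring
  rw [hder, hint]
  have : survival Q x s s = 1 := by simp [survival]
  linarith [survival_pos Q x s t]

end IsBoundedRate

lemma Piter_succ [MeasurableSpace E] (Q : ℝ → E → Measure E) (n : ℕ) (s t : ℝ) (x : E) :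
    Piter Q (n + 1) s t x = ((volume.restrict (Ioc s t)).withDensity fun r =>
      ENNReal.ofReal (survival Q x s r)).bind fun r => (Q r x).bind fun y => Piter Q n r t y :=
  rfl

namespace IsBoundedRate

variable [MeasurableSpace E] {Q : ℝ → E → Measure E} {W : E → ℝ}

lemma measurable_bind (h : IsBoundedRate Q W) {κ : ℝ → E → Measure E}
    (hκ : Measurable fun p : ℝ × E => κ p.1 p.2) :
    Measurable fun p : ℝ × E => (Q p.1 p.2).bind (κ p.1) := by
  refine Measure.measurable_of_measurable_coe _ fun A hA => ?_
  have : ∀ p : ℝ × E, ((Q p.1 p.2).bind (κ p.1)) A =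
      ∫⁻ y, κ p.1 y A ∂Q p.1 p.2 := fun p =>
    Measure.bind_apply hA (hκ.comp (measurable_prodMk_left (x := p.1))).aemeasurable
  simp only [this]
  exact measurable_lintegral_of_isFiniteMeasure h.measurable
    (fun p => h.isFiniteMeasure p.1 p.2)
    (f := fun z : (ℝ × E) × E => κ z.1.1 z.2 A)
    ((Measure.measurable_coe hA).comp
      (hκ.comp (by fun_prop : Measurable fun z : (ℝ × E) × E => (z.1.1, z.2))))

lemma measurable_bind_left (h : IsBoundedRate Q W) {κ : ℝ → E → Measure E}
    (hκ : Measurable fun p : ℝ × E => κ p.1 p.2) (x : E) :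
    Measurable fun r => (Q r x).bind (κ r) := by
  have hx : Measurable fun r : ℝ => (r, x) := measurable_prodMk_right
  have := (h.measurable_bind hκ).comp hx
  exact this

lemma lintegral_withDensity_survival (h : IsBoundedRate Q W) (s t : ℝ) (x : E) {g : ℝ → ℝ≥0∞}
    (hg : Measurable g) :
    ∫⁻ r, g r ∂((volume.restrict (Ioc s t)).withDensity fun r =>
        ENNReal.ofReal (survival Q x s r)) =
      ∫⁻ r in Ioc s t, ENNReal.ofReal (survival Q x s r) * g r :=
  lintegral_withDensity_eq_lintegral_mul _ (h.measurable_survival_right x s).ennreal_ofReal hg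

lemma measurable_Piter (h : IsBoundedRate Q W) (n : ℕ) (t : ℝ) :
    Measurable fun p : ℝ × E => Piter Q n p.1 t p.2 := by
  induction n with
  | zero =>
    refine Measure.measurable_of_measurable_coe _ fun A hA => ?_
    simp only [Piter, Measure.smul_apply, smul_eq_mul, Measure.dirac_apply' _ hA]
    have h1 : Measurable fun p : ℝ × E => survival Q p.2 p.1 t :=
      h.measurable_survival.comp (by fun_prop : Measurable fun p : ℝ × E => (p, t))
    exact h1.ennreal_ofReal.mul ((measurable_one.indicator hA).comp measurable_snd)
  | succ n ih =>
    have hb : Measurable fun p : ℝ × E => (Q p.1 p.2).bind fun y => Piter Q n p.1 t y :=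
      h.measurable_bind (κ := fun r y => Piter Q n r t y) ih
    refine Measure.measurable_of_measurable_coe _ fun A hA => ?_
    have hbA : Measurable fun p : ℝ × E => ((Q p.1 p.2).bind fun y => Piter Q n p.1 t y) A :=
      (Measure.measurable_coe hA).comp hb
    have hS : MeasurableSet {z : (ℝ × E) × ℝ | z.1.1 < z.2 ∧ z.2 ≤ t} :=
      (measurableSet_lt (measurable_fst.comp measurable_fst) measurable_snd).inter
        (measurableSet_le measurable_snd measurable_const)
    have hm : Measurable fun z : (ℝ × E) × ℝ => ENNReal.ofReal (survival Q z.1.2 z.1.1 z.2) *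
        ((Q z.2 z.1.2).bind fun y => Piter Q n z.2 t y) A :=
      have hm1 : Measurable fun z : (ℝ × E) × ℝ =>
          ((Q z.2 z.1.2).bind fun y => Piter Q n z.2 t y) A :=
        Measurable.comp (f := fun z : (ℝ × E) × ℝ => (z.2, z.1.2)) hbA (by fun_prop)
      h.measurable_survival.ennreal_ofReal.mul hm1
    have hI := (hm.indicator hS).lintegral_prod_right' (ν := volume)
    refine (congrArg Measurable (funext fun p => ?_)).mpr hI
    have hbx : Measurable fun r => (Q r p.2).bind fun y => Piter Q n r t y :=
      h.measurable_bind_left (κ := fun r y => Piter Q n r t y) ih p.2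
    have hbAx : Measurable fun r => ((Q r p.2).bind fun y => Piter Q n r t y) A :=
      (Measure.measurable_coe hA).comp hbx
    rw [Piter_succ, Measure.bind_apply hA hbx.aemeasurable,
      h.lintegral_withDensity_survival p.1 t p.2 hbAx,
      ← lintegral_indicator measurableSet_Ioc]
    refine lintegral_congr fun r => ?_
    simp only [indicator, mem_ofPred_eq, mem_Ioc]

lemma measurable_Piter_right (h : IsBoundedRate Q W) (n : ℕ) (s t : ℝ) :
    Measurable fun x => Piter Q n s t x :=
  (h.measurable_Piter n t).comp measurable_prodMk_left

lemma lintegral_Piter_zero (s t : ℝ) (x : E) {f : E → ℝ≥0∞}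
    (hf : Measurable f) :
    ∫⁻ z, f z ∂Piter Q 0 s t x = ENNReal.ofReal (survival Q x s t) * f x := by
  rw [Piter, lintegral_smul_measure, lintegral_dirac' _ hf, survival, smul_eq_mul]

lemma measurable_lintegral_Piter (h : IsBoundedRate Q W) (n : ℕ) (t : ℝ) {f : E → ℝ≥0∞}
    (hf : Measurable f) : Measurable fun p : ℝ × E => ∫⁻ z, f z ∂Piter Q n p.1 t p.2 :=
  (Measure.measurable_lintegral hf).comp (h.measurable_Piter n t)

lemma measurable_lintegral_rate (h : IsBoundedRate Q W) {g : ℝ → E → ℝ≥0∞}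
    (hg : Measurable fun p : ℝ × E => g p.1 p.2) :
    Measurable fun p : ℝ × E => ∫⁻ y, g p.1 y ∂Q p.1 p.2 :=
  measurable_lintegral_of_isFiniteMeasure h.measurable (fun p => h.isFiniteMeasure p.1 p.2)
    (f := fun z : (ℝ × E) × E => g z.1.1 z.2)
    (hg.comp (by fun_prop : Measurable fun z : (ℝ × E) × E => (z.1.1, z.2)))

lemma measurable_lintegral_rate_left (h : IsBoundedRate Q W) {g : ℝ → E → ℝ≥0∞}
    (hg : Measurable fun p : ℝ × E => g p.1 p.2) (x : E) :
    Measurable fun r => ∫⁻ y, g r y ∂Q r x :=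
  (h.measurable_lintegral_rate hg).comp (g := fun p : ℝ × E => ∫⁻ y, g p.1 y ∂Q p.1 p.2)
    (measurable_prodMk_right (y := x))

lemma lintegral_Piter_succ (h : IsBoundedRate Q W) (n : ℕ) (s t : ℝ) (x : E) {f : E → ℝ≥0∞}
    (hf : Measurable f) :
    ∫⁻ z, f z ∂Piter Q (n + 1) s t x = ∫⁻ r in Ioc s t,
      ENNReal.ofReal (survival Q x s r) * ∫⁻ y, ∫⁻ z, f z ∂Piter Q n r t y ∂Q r x := by
  have hbx : Measurable fun r => (Q r x).bind fun y => Piter Q n r t y :=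
    h.measurable_bind_left (κ := fun r y => Piter Q n r t y) (h.measurable_Piter n t) x
  have hgx := h.measurable_lintegral_rate_left (g := fun r y => ∫⁻ z, f z ∂Piter Q n r t y)
    (h.measurable_lintegral_Piter n t hf) x
  rw [Piter_succ, Measure.lintegral_bind hbx.aemeasurable hf.aemeasurable]
  have hi : ∀ r, ∫⁻ z, f z ∂((Q r x).bind fun y => Piter Q n r t y) =
      ∫⁻ y, ∫⁻ z, f z ∂Piter Q n r t y ∂Q r x := fun r =>
    Measure.lintegral_bind (h.measurable_Piter_right n r t).aemeasurable hf.aemeasurable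
  simp only [hi]
  exact h.lintegral_withDensity_survival s t x hgx

lemma Piter_univ_le_one (h : IsBoundedRate Q W) (n : ℕ) {s t : ℝ} (hst : s ≤ t) (x : E) :
    Piter Q n s t x univ ≤ 1 := by
  induction n generalizing s x with
  | zero =>
    rw [← lintegral_one, lintegral_Piter_zero s t x measurable_const, mul_one,
      ENNReal.ofReal_le_one]
    exact survival_le_one Q x hst
  | succ n ih =>
    rw [← lintegral_one, h.lintegral_Piter_succ n s t x measurable_const]
    have hint : IntegrableOn (fun r => survival Q x s r * qIntensity Q r x) (Ioc s t) := by
      refine Measure.integrableOn_of_bounded (M := |W x|) measure_Ioc_lt_top.ne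
        ((h.measurable_survival_right x s).mul
          (h.measurable_qIntensity_left x)).aestronglyMeasurable ?_
      refine (ae_restrict_iff' measurableSet_Ioc).2 (.of_forall fun r hr => ?_)
      have h1 := survival_le_one Q x hr.1.le
      have h2 := qIntensity_nonneg Q r x
      rw [Real.norm_of_nonneg (mul_nonneg (survival_pos _ _ _ _).le h2)]
      exact (mul_le_of_le_one_left h2 h1).trans (h.qIntensity_le r x)
    calc _ ≤ ∫⁻ r in Ioc s t, ENNReal.ofReal (survival Q x s r * qIntensity Q r x) := by
          refine setLIntegral_mono' measurableSet_Ioc fun r hr => ?_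
          rw [ENNReal.ofReal_mul (survival_pos _ _ _ _).le]
          gcongr
          have := h.isFiniteMeasure r x
          rw [qIntensity, ENNReal.ofReal_toReal (measure_ne_top _ _)]
          calc _ ≤ ∫⁻ _, 1 ∂Q r x := lintegral_mono fun y => by
                rw [lintegral_one]; exact ih hr.2 y
            _ = _ := lintegral_one
      _ = ENNReal.ofReal (∫ r in Ioc s t, survival Q x s r * qIntensity Q r x) :=
          (ofReal_integral_eq_lintegral_ofReal hint (.of_forall fun r =>
            mul_nonneg (survival_pos _ _ _ _).le (qIntensity_nonneg Q r x))).symm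
      _ ≤ 1 := by
          rw [ENNReal.ofReal_le_one, ← intervalIntegral.integral_of_le hst]
          exact h.integral_survival_mul_le_one x hst

/-- Chapman–Kolmogorov relation for the iterated kernels. -/
lemma lintegral_Piter_eq_sum (h : IsBoundedRate Q W) (n : ℕ) {s r t : ℝ} (hsr : s ≤ r)
    (hrt : r ≤ t) (x : E) {f : E → ℝ≥0∞} (hf : Measurable f) :
    ∫⁻ z, f z ∂Piter Q n s t x = ∑ p ∈ Finset.HasAntidiagonal.antidiagonal n,
      ∫⁻ y, ∫⁻ z, f z ∂Piter Q p.2 r t y ∂Piter Q p.1 s r x := by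
  have hmeas : ∀ k, Measurable fun y => ∫⁻ z, f z ∂Piter Q k r t y := fun k =>
    (h.measurable_lintegral_Piter k t hf).comp measurable_prodMk_left
  induction n generalizing s x with
  | zero =>
    rw [Finset.Nat.antidiagonal_zero, Finset.sum_singleton, lintegral_Piter_zero s r x (hmeas 0),
      lintegral_Piter_zero s t x hf, lintegral_Piter_zero r t x hf, ← mul_assoc,
      ← ENNReal.ofReal_mul (survival_pos _ _ _ _).le, h.survival_mul]
  | succ n ih =>
    have hms : ∀ s, Measurable fun r => ENNReal.ofReal (survival Q x s r) := fun s =>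
      (h.measurable_survival_right x s).ennreal_ofReal
    rw [h.lintegral_Piter_succ n s t x hf, ← Ioc_union_Ioc_eq_Ioc hsr hrt,
      lintegral_union measurableSet_Ioc (Ioc_disjoint_Ioc_of_le le_rfl),
      Finset.Nat.sum_antidiagonal_succ, add_comm, lintegral_Piter_zero s r x (hmeas _),
      h.lintegral_Piter_succ n r t x hf]
    congr 1
    · have hm2 : Measurable fun τ => ∫⁻ y, ∫⁻ z, f z ∂Piter Q n τ t y ∂Q τ x :=
        h.measurable_lintegral_rate_left (g := fun r y => ∫⁻ z, f z ∂Piter Q n r t y)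
          (h.measurable_lintegral_Piter n t hf) x
      refine Eq.trans ?_ (lintegral_const_mul _ ((hms r).mul hm2))
      refine lintegral_congr fun τ => ?_
      rw [← mul_assoc, ← ENNReal.ofReal_mul (survival_pos _ _ _ _).le, h.survival_mul]
    · have hmm : ∀ p : ℕ × ℕ, Measurable fun q : ℝ × E =>
          ∫⁻ y, ∫⁻ z, f z ∂Piter Q p.2 r t y ∂Piter Q p.1 q.1 r q.2 := fun p =>
        h.measurable_lintegral_Piter p.1 r (hmeas p.2)
      simp only [h.lintegral_Piter_succ _ s r x (hmeas _)]
      have hmr : ∀ p : ℕ × ℕ, Measurable fun τ => ENNReal.ofReal (survival Q x s τ) *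
          ∫⁻ y, ∫⁻ y', ∫⁻ z, f z ∂Piter Q p.2 r t y' ∂Piter Q p.1 τ r y ∂Q τ x := fun p =>
        (hms s).mul (h.measurable_lintegral_rate_left
          (g := fun τ y => ∫⁻ y', ∫⁻ z, f z ∂Piter Q p.2 r t y' ∂Piter Q p.1 τ r y) (hmm p) x)
      have hmy : ∀ (p : ℕ × ℕ) τ, Measurable fun y =>
          ∫⁻ y', ∫⁻ z, f z ∂Piter Q p.2 r t y' ∂Piter Q p.1 τ r y := fun p τ =>
        (hmm p).comp (measurable_prodMk_left (x := τ))
      rw [← lintegral_finsetSum _ fun p _ => hmr p]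
      refine setLIntegral_congr_fun measurableSet_Ioc fun τ hτ => ?_
      rw [← Finset.mul_sum, ← lintegral_finsetSum _ fun p _ => hmy p τ]
      congr 1
      exact lintegral_congr fun y => ih hτ.2 y

end IsBoundedRate

namespace IsBoundedRate

variable [MeasurableSpace E] {Q : ℝ → E → Measure E} {W : E → ℝ}

lemma isFiniteMeasure_Piter (h : IsBoundedRate Q W) (n : ℕ) (s t : ℝ) (x : E) :
    IsFiniteMeasure (Piter Q n s t x) := by
  rcases le_or_gt s t with hst | hts
  · exact ⟨(h.Piter_univ_le_one n hst x).trans_lt one_lt_top⟩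
  · refine ⟨?_⟩
    rw [← lintegral_one]
    cases n with
    | zero =>
      rw [lintegral_Piter_zero s t x measurable_const, mul_one]
      exact ENNReal.ofReal_lt_top
    | succ n =>
      rw [h.lintegral_Piter_succ n s t x measurable_const, Ioc_eq_empty hts.le.not_gt]
      simp

lemma measurable_integral_Piter (h : IsBoundedRate Q W) (n : ℕ) (t : ℝ) {F : E → ℝ}
    (hF : Measurable F) : Measurable fun p : ℝ × E => ∫ y, F y ∂Piter Q n p.1 t p.2 :=
  measurable_integral_of_isFiniteMeasure (h.measurable_Piter n t)
    (fun p => h.isFiniteMeasure_Piter n p.1 t p.2) (f := fun z : (ℝ × E) × E => F z.2)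
    (hF.comp measurable_snd)

lemma measurable_integral_rate_left (h : IsBoundedRate Q W) {g : ℝ → E → ℝ}
    (hg : Measurable fun p : ℝ × E => g p.1 p.2) (x : E) :
    Measurable fun r => ∫ y, g r y ∂Q r x := by
  have hx : Measurable fun r : ℝ => (r, x) := measurable_prodMk_right
  have hκ : Measurable fun r => Q r x := by
    have := h.measurable.comp hx
    exact this
  exact measurable_integral_of_isFiniteMeasure hκ (fun r => h.isFiniteMeasure r x)
    (f := fun z : ℝ × E => g z.1 z.2) hg

lemma abs_integral_Piter_le (h : IsBoundedRate Q W) (n : ℕ) {s t : ℝ} (hst : s ≤ t) (x : E)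
    {F : E → ℝ} {M : ℝ} (hM : ∀ y, |F y| ≤ M) : |∫ y, F y ∂Piter Q n s t x| ≤ M := by
  have := h.isFiniteMeasure_Piter n s t x
  have h0 : 0 ≤ M := (abs_nonneg _).trans (hM x)
  refine (norm_integral_le_of_norm_le_const (f := F) (.of_forall hM)).trans ?_
  refine mul_le_of_le_one_right h0 ?_
  exact ENNReal.toReal_le_of_le_ofReal zero_le_one
    (by simpa using h.Piter_univ_le_one n hst x)

lemma integral_Piter_zero (s t : ℝ) (x : E) {F : E → ℝ} (hF : Measurable F) :
    ∫ y, F y ∂Piter Q 0 s t x = survival Q x s t * F x := by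
  rw [Piter, integral_smul_measure, integral_dirac' _ _ hF.stronglyMeasurable, smul_eq_mul]
  congr 1
  exact ENNReal.toReal_ofReal (survival_pos Q x s t).le

lemma integral_Piter_succ (h : IsBoundedRate Q W) (n : ℕ) (s t : ℝ) (x : E)
    {F : E → ℝ} (hF : Measurable F) {M : ℝ} (hM : ∀ y, |F y| ≤ M) :
    ∫ z, F z ∂Piter Q (n + 1) s t x = ∫ r in Ioc s t,
      survival Q x s r * ∫ y, ∫ z, F z ∂Piter Q n r t y ∂Q r x := by
  have hbx : Measurable fun r => (Q r x).bind fun y => Piter Q n r t y :=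
    h.measurable_bind_left (κ := fun r y => Piter Q n r t y) (h.measurable_Piter n t) x
  have hfin := h.isFiniteMeasure_Piter (n + 1) s t x
  rw [Piter_succ] at hfin ⊢
  rw [integral_bind_of_bounded hbx.aemeasurable hfin hF hM,
    integral_withDensity_eq_integral_toReal_smul
      (h.measurable_survival_right x s).ennreal_ofReal (.of_forall fun _ => ENNReal.ofReal_lt_top)]
  refine setIntegral_congr_fun measurableSet_Ioc fun r hr => ?_
  simp only [smul_eq_mul, ENNReal.toReal_ofReal (survival_pos Q x s r).le]
  congr 1
  have hκ := (h.measurable_Piter_right n r t).aemeasurable (μ := Q r x)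
  refine integral_bind_of_bounded hκ ⟨?_⟩ hF hM
  rw [Measure.bind_apply .univ hκ]
  calc _ ≤ ∫⁻ _, 1 ∂Q r x := lintegral_mono fun y => h.Piter_univ_le_one n hr.2 y
    _ < ∞ := by
      rw [lintegral_one]
      exact (h.isFiniteMeasure r x).measure_univ_lt_top

end IsBoundedRate

lemma survival_congr [MeasurableSpace E] {Q Q' : ℝ → E → Measure E} {s t : ℝ}
    (hQ : ∀ r ∈ Ioo s t, ∀ x, Q r x = Q' r x) {a b : ℝ} (ha : s ≤ a) (hab : a ≤ b) (hb : b ≤ t)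
    (x : E) : survival Q x a b = survival Q' x a b := by
  unfold survival
  congr 2
  rw [intervalIntegral.integral_of_le hab, intervalIntegral.integral_of_le hab,
    integral_Ioc_eq_integral_Ioo, integral_Ioc_eq_integral_Ioo]
  refine setIntegral_congr_fun measurableSet_Ioo fun r hr => ?_
  simp only [qIntensity, hQ r ⟨ha.trans_lt hr.1, hr.2.trans_le hb⟩ x]

/-- The iterated kernels on `[a,t]` only depend on the rates in the open interval. -/
lemma Piter_congr [MeasurableSpace E] {Q Q' : ℝ → E → Measure E} {s t : ℝ}
    (hQ : ∀ r ∈ Ioo s t, ∀ x, Q r x = Q' r x) (n : ℕ) {a : ℝ} (ha : s ≤ a) (hat : a ≤ t)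
    (x : E) : Piter Q n a t x = Piter Q' n a t x := by
  induction n generalizing a x with
  | zero =>
    have := survival_congr hQ ha hat le_rfl x
    unfold survival at this
    rw [Piter, Piter, this]
  | succ n ih =>
    rw [Piter_succ, Piter_succ]
    have e1 : ((volume.restrict (Ioc a t)).withDensity fun r =>
        ENNReal.ofReal (survival Q x a r)) = ((volume.restrict (Ioc a t)).withDensity fun r =>
        ENNReal.ofReal (survival Q' x a r)) := by
      refine withDensity_congr_ae ?_
      refine (ae_restrict_iff' measurableSet_Ioc).2 (.of_forall fun r hr => ?_)
      dsimp only
      rw [survival_congr hQ ha hr.1.le hr.2]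
    rw [e1]
    refine Measure.bind_congr_right ((withDensity_absolutelyContinuous _ _).ae_le ?_)
    refine (ae_restrict_congr_set Ioo_ae_eq_Ioc).mp ?_
    refine (ae_restrict_iff' measurableSet_Ioo).2 (.of_forall fun r hr => ?_)
    dsimp only
    rw [hQ r ⟨ha.trans_lt hr.1, hr.2⟩ x]
    refine Measure.bind_congr_right (.of_forall fun y => ?_)
    exact ih (ha.trans hr.1.le) hr.2.le y

lemma Ualpha_congr [MeasurableSpace E] {Q Q' : ℝ → E → Measure E} (α : ℝ) {s t : ℝ} (hst : s ≤ t)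
    (hQ : ∀ r ∈ Ioo s t, ∀ x, Q r x = Q' r x) (F : E → ℝ) :
    Ualpha Q α s t F = Ualpha Q' α s t F := by
  ext x
  simp only [Ualpha, Piter_congr hQ _ le_rfl hst]

/-- For a time-homogeneous rate the iterated kernels are translation invariant. -/
lemma Piter_const_shift [MeasurableSpace E] {q : E → Measure E} {W : E → ℝ}
    (h : IsBoundedRate (fun _ => q) W) (n : ℕ) (s t : ℝ) (x : E) :
    Piter (fun _ => q) n s t x = Piter (fun _ => q) n 0 (t - s) x := by
  have hsurv : ∀ (d s r : ℝ) (x : E), survival (fun _ => q) x (s - d) (r - d) =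
      survival (fun _ => q) x s r := fun d s r x => by
    simp [survival, qIntensity]
  have key : ∀ (d s t : ℝ) (x : E),
      Piter (fun _ => q) n s t x = Piter (fun _ => q) n (s - d) (t - d) x := by
    intro d s t x
    refine Measure.ext_of_lintegral _ fun f hf => ?_
    induction n generalizing s x with
    | zero =>
      rw [IsBoundedRate.lintegral_Piter_zero _ _ _ hf, IsBoundedRate.lintegral_Piter_zero _ _ _ hf,
        hsurv]
    | succ n ih =>
      rw [h.lintegral_Piter_succ n _ _ _ hf, h.lintegral_Piter_succ n _ _ _ hf]
      have hpre : (fun r : ℝ => r - d) ⁻¹' Ioc (s - d) (t - d) = Ioc s t := by simp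
      rw [← (measurePreserving_sub_right volume d).setLIntegral_comp_preimage_emb
        (MeasurableEquiv.subRight d).measurableEmbedding _ (Ioc (s - d) (t - d)), hpre]
      refine lintegral_congr fun r => ?_
      rw [hsurv]
      simp only [ih r]
  simpa using key s s t x

lemma Ualpha_eq_Talpha [MeasurableSpace E] {Q Q' : ℝ → E → Measure E} {W : E → ℝ} (α : ℝ)
    {r a b : ℝ} (hab : a ≤ b) (h : IsBoundedRate (fun _ => Q r) W)
    (hQ : ∀ τ ∈ Ioo a b, ∀ x, Q' τ x = Q r x) (F : E → ℝ) :
    Ualpha Q' α a b F = Talpha Q α r (b - a) F := by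
  rw [Ualpha_congr (Q' := fun _ => Q r) α hab hQ]
  ext x
  simp only [Talpha, Ualpha, Piter_const_shift h _ a b]

/-- The kernels `Σ_n αⁿ P⁽ⁿ⁾(s,x;t,·)` of the `α`-regularized evolution. -/
noncomputable def regularizedKernel [MeasurableSpace E] (Q : ℝ → E → Measure E) (α : ℝ)
    (s t : ℝ) (x : E) : Measure E :=
  Measure.sum fun n => ENNReal.ofReal α ^ n • Piter Q n s t x

lemma lintegral_regularizedKernel [MeasurableSpace E] (Q : ℝ → E → Measure E) (α s t : ℝ) (x : E)
    (f : E → ℝ≥0∞) : ∫⁻ z, f z ∂regularizedKernel Q α s t x =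
      ∑' n, ENNReal.ofReal α ^ n * ∫⁻ z, f z ∂Piter Q n s t x := by
  simp only [regularizedKernel, lintegral_sum_measure, lintegral_smul_measure, smul_eq_mul]

namespace IsBoundedRate

variable [MeasurableSpace E] {Q : ℝ → E → Measure E} {W : E → ℝ} {α : ℝ}

lemma isFiniteMeasure_regularizedKernel (h : IsBoundedRate Q W) (hα : α < 1) {s t : ℝ}
    (hst : s ≤ t) (x : E) : IsFiniteMeasure (regularizedKernel Q α s t x) := by
  refine ⟨?_⟩
  rw [← lintegral_one, lintegral_regularizedKernel]
  calc _ ≤ ∑' n, ENNReal.ofReal α ^ n := ENNReal.tsum_le_tsum fun n => by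
        rw [lintegral_one]
        exact mul_le_of_le_one_right' (h.Piter_univ_le_one n hst x)
    _ < ∞ := by
        rw [ENNReal.tsum_geometric]
        exact ENNReal.inv_lt_top.2 (tsub_pos_of_lt (by simpa using hα))

lemma measurable_regularizedKernel (h : IsBoundedRate Q W) (s t : ℝ) :
    Measurable fun x => regularizedKernel Q α s t x := by
  refine Measure.measurable_of_measurable_coe _ fun A hA => ?_
  simp only [regularizedKernel, Measure.sum_apply _ hA, Measure.smul_apply, smul_eq_mul]
  exact Measurable.tsum fun n =>
    ((Measure.measurable_coe hA).comp (h.measurable_Piter_right n s t)).const_mul _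

lemma Ualpha_eq_integral (h : IsBoundedRate Q W) (hα : α ∈ Ioo (0 : ℝ) 1) {s t : ℝ}
    (hst : s ≤ t) {F : E → ℝ} (hF : Measurable F) {M : ℝ} (hM : ∀ y, |F y| ≤ M) (x : E) :
    Ualpha Q α s t F x = ∫ y, F y ∂regularizedKernel Q α s t x := by
  have := h.isFiniteMeasure_regularizedKernel hα.2 hst x
  have hi : Integrable F (regularizedKernel Q α s t x) :=
    .of_bound hF.aestronglyMeasurable M (.of_forall hM)
  unfold regularizedKernel at hi ⊢
  rw [← (hasSum_integral_measure hi).tsum_eq, Ualpha]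
  refine tsum_congr fun n => ?_
  rw [integral_smul_measure, ENNReal.toReal_pow, ENNReal.toReal_ofReal hα.1.le, smul_eq_mul]

lemma measurable_Ualpha (h : IsBoundedRate Q W) (hα : α ∈ Ioo (0 : ℝ) 1) {s t : ℝ}
    (hst : s ≤ t) {F : E → ℝ} (hF : Measurable F) {M : ℝ} (hM : ∀ y, |F y| ≤ M) :
    Measurable (Ualpha Q α s t F) := by
  have e : Ualpha Q α s t F = fun x => ∫ y, F y ∂regularizedKernel Q α s t x :=
    funext (h.Ualpha_eq_integral hα hst hF hM)
  rw [e]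
  exact measurable_integral_of_isFiniteMeasure (h.measurable_regularizedKernel s t)
    (h.isFiniteMeasure_regularizedKernel hα.2 hst) (f := fun z : E × E => F z.2)
    (hF.comp measurable_snd)

lemma abs_Ualpha_le (h : IsBoundedRate Q W) (hα : α ∈ Ioo (0 : ℝ) 1) {s t : ℝ}
    (hst : s ≤ t) {F : E → ℝ} {M : ℝ} (hM : ∀ y, |F y| ≤ M) (x : E) :
    |Ualpha Q α s t F x| ≤ ∑' n : ℕ, α ^ n * M := by
  refine tsum_of_norm_bounded (E := ℝ)
    ((summable_geometric_of_lt_one hα.1.le hα.2).mul_right M).hasSum fun n => ?_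
  rw [norm_mul, norm_pow, Real.norm_of_nonneg hα.1.le]
  gcongr
  · exact pow_nonneg hα.1.le n
  · exact h.abs_integral_Piter_le n hst x hM

lemma regularizedKernel_eq_bind (h : IsBoundedRate Q W) {s r t : ℝ} (hsr : s ≤ r) (hrt : r ≤ t)
    (x : E) : regularizedKernel Q α s t x =
      (regularizedKernel Q α s r x).bind fun y => regularizedKernel Q α r t y := by
  refine Measure.ext_of_lintegral _ fun f hf => ?_
  have hmeas : ∀ k, Measurable fun y => ∫⁻ z, f z ∂Piter Q k r t y := fun k =>
    (h.measurable_lintegral_Piter k t hf).comp measurable_prodMk_left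
  rw [Measure.lintegral_bind (h.measurable_regularizedKernel r t).aemeasurable hf.aemeasurable,
    lintegral_regularizedKernel, lintegral_regularizedKernel]
  simp only [lintegral_regularizedKernel, h.lintegral_Piter_eq_sum _ hsr hrt x hf]
  have e1 : ∀ k, ∫⁻ y, ∑' n, ENNReal.ofReal α ^ n * ∫⁻ z, f z ∂Piter Q n r t y ∂Piter Q k s r x =
      ∑' n, ENNReal.ofReal α ^ n * ∫⁻ y, ∫⁻ z, f z ∂Piter Q n r t y ∂Piter Q k s r x := fun k => by
    rw [lintegral_tsum fun n => ((hmeas n).const_mul _).aemeasurable]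
    exact tsum_congr fun n => lintegral_const_mul _ (hmeas n)
  simp only [e1, ← ENNReal.tsum_mul_left]
  rw [← ENNReal.tsum_prod, ← Finset.HasAntidiagonal.sigmaAntidiagonalEquivProd.tsum_eq,
    ENNReal.tsum_sigma']
  refine tsum_congr fun n => ?_
  rw [tsum_fintype, Finset.mul_sum, ← Finset.sum_coe_sort]
  refine Finset.sum_congr rfl fun p _ => ?_
  rw [← mul_assoc, ← pow_add]
  congr 2
  exact (Finset.HasAntidiagonal.mem_antidiagonal.1 p.2).symm

/-- The evolution property of the regularized evolution. -/
lemma Ualpha_comp (h : IsBoundedRate Q W) (hα : α ∈ Ioo (0 : ℝ) 1) {s r t : ℝ} (hsr : s ≤ r)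
    (hrt : r ≤ t) {F : E → ℝ} (hF : Measurable F) {M : ℝ} (hM : ∀ y, |F y| ≤ M) :
    Ualpha Q α s t F = Ualpha Q α s r (Ualpha Q α r t F) := by
  ext x
  have hfin := h.isFiniteMeasure_regularizedKernel hα.2 (hsr.trans hrt) x
  rw [h.Ualpha_eq_integral hα (hsr.trans hrt) hF hM, h.Ualpha_eq_integral hα hsr
    (h.measurable_Ualpha hα hrt hF hM) (h.abs_Ualpha_le hα hrt hM)]
  rw [h.regularizedKernel_eq_bind hsr hrt] at hfin ⊢
  rw [integral_bind_of_bounded (h.measurable_regularizedKernel r t).aemeasurable hfin hF hM]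
  simp only [h.Ualpha_eq_integral hα hrt hF hM]

end IsBoundedRate

lemma IsBoundedRate.comp [MeasurableSpace E] {Q : ℝ → E → Measure E} {W : E → ℝ}
    (h : IsBoundedRate Q W) {φ : ℝ → ℝ} (hφ : Measurable φ) :
    IsBoundedRate (fun r => Q (φ r)) W where
  measurable := by
    have hp : Measurable fun p : ℝ × E => (φ p.1, p.2) :=
      (hφ.comp measurable_fst).prodMk measurable_snd
    have := h.measurable.comp hp
    exact this
  le r x := h.le (φ r) x

/-- A transition function restricted to the time interval `[0,T]`, and zero outside. -/
noncomputable def truncatedRate [MeasurableSpace E] (Q : ℝ → E → Measure E) (T : ℝ) :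
    ℝ → E → Measure E :=
  (Icc 0 T).indicator Q

lemma truncatedRate_of_mem [MeasurableSpace E] {Q : ℝ → E → Measure E} {T r : ℝ}
    (hr : r ∈ Icc 0 T) : truncatedRate Q T r = Q r :=
  indicator_of_mem hr Q

lemma isBoundedRate_truncatedRate [MeasurableSpace E] [TopologicalSpace E]
    {Q : ℝ → E → Measure E} (hQ : IsTransitionFunction Q) {W : E → ℝ} {T : ℝ}
    (hW : ∀ t ∈ Icc 0 T, ∀ x, qIntensity Q t x ≤ W x) : IsBoundedRate (truncatedRate Q T) W where
  measurable := by
    refine Measure.measurable_of_measurable_coe _ fun A hA => ?_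
    have hS : MeasurableSet {p : ℝ × E | p.1 ∈ Icc 0 T} := measurable_fst measurableSet_Icc
    convert (hQ.2.2.1 A hA).indicator hS with p
    by_cases hp : p.1 ∈ Icc 0 T
    · rw [truncatedRate_of_mem hp, indicator_of_mem (by exact hp)]
    · rw [truncatedRate, indicator_of_notMem hp, indicator_of_notMem (by exact hp)]
      rfl
  le r x := by
    by_cases hr : r ∈ Icc 0 T
    · have := hQ.1 r x hr.1
      rw [truncatedRate_of_mem hr, ← ENNReal.ofReal_toReal (measure_ne_top (Q r x) univ)]
      exact ENNReal.ofReal_le_ofReal (hW r hr x)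
    · rw [truncatedRate, indicator_of_notMem hr]
      simp

/-- The left endpoint of the partition interval containing a given time. -/
lemma exists_measurable_leftEndpoint {t : ℕ → ℝ} (ht0 : t 0 = 0) (htmono : StrictMono t)
    (httop : Tendsto t atTop atTop) : ∃ φ : ℝ → ℝ, Measurable φ ∧
      ∀ r, 0 ≤ r → ∃ k, φ r = t k ∧ t k ≤ r ∧ r < t (k + 1) := by
  classical
  have hex : ∀ r, ∃ k, r < t k := fun r => (httop.eventually_gt_atTop r).exists
  refine ⟨fun r => t (Nat.find (hex r) - 1), Monotone.measurable fun a b hab => ?_, fun r hr => ?_⟩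
  · refine htmono.monotone (Nat.sub_le_sub_right ?_ 1)
    exact Nat.find_mono fun k hk => hab.trans_lt hk
  · have hpos : 0 < Nat.find (hex r) := by
      rw [Nat.find_pos, ht0]
      exact not_lt.2 hr
    refine ⟨_, rfl, not_lt.1 (Nat.find_min (hex r) (Nat.sub_lt hpos one_pos)), ?_⟩
    rw [Nat.sub_add_cancel hpos]
    exact Nat.find_spec (hex r)

/-- The evolution of a piecewise constant rate is a finite product of semigroups. -/
lemma Ualpha_eq_foldr_Talpha [MeasurableSpace E] {Q R : ℝ → E → Measure E} {W : E → ℝ}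
    (hR : IsBoundedRate R W) {α : ℝ} (hα : α ∈ Ioo (0 : ℝ) 1) {t : ℕ → ℝ} (ht : StrictMono t)
    {u : ℝ} (hQ : ∀ k, t k ≤ u → IsBoundedRate (fun _ => Q (t k)) W)
    (hRQ : ∀ k r x, t k ≤ r → r < t (k + 1) → r ≤ u → R r x = Q (t k) x)
    {F : E → ℝ} (hF : Measurable F) {M : ℝ} (hM : ∀ y, |F y| ≤ M) (d : ℕ) {s : ℝ} {m : ℕ}
    (hms : t m ≤ s) (hsm : s ≤ t (m + 1)) (hsu : s ≤ u) (hdu : t (m + d) ≤ u)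
    (hud : u ≤ t (m + d + 1)) :
    Ualpha R α s u F =
      ((List.range (d + 1)).map fun i =>
        (t (m + i), (if m + i = m + d then u else t (m + i + 1)) -
          (if i = 0 then s else t (m + i)))).foldr (fun pr G => Talpha Q α pr.1 pr.2 G) F := by
  induction d generalizing s m with
  | zero =>
    simp only [zero_add, List.range_one, List.map_cons, List.map_nil, List.foldr_cons,
      List.foldr_nil, add_zero, if_true]
    exact Ualpha_eq_Talpha α hsu (hQ m (hms.trans hsu))
      (fun τ hτ x => hRQ m τ x (hms.trans hτ.1.le) (hτ.2.trans_le hud) hτ.2.le) F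
  | succ d ih =>
    have hmu : t (m + 1) ≤ u := (ht.monotone (by omega)).trans hdu
    have h1 := ih (s := t (m + 1)) (m := m + 1) le_rfl (ht.monotone (Nat.le_succ _)) hmu
      (by convert hdu using 2; omega) (by convert hud using 2; omega)
    rw [hR.Ualpha_comp hα hsm hmu hF hM, List.range_succ_eq_map, List.map_cons, List.foldr_cons,
      List.map_map, h1, Ualpha_eq_Talpha α hsm (hQ m (hms.trans hsu))
        (fun τ hτ x => hRQ m τ x (hms.trans hτ.1.le) hτ.2 (hτ.2.le.trans hmu))]
    have hne : m ≠ m + (d + 1) := by omega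
    simp only [add_zero, if_neg hne, if_true]
    congr 2
    refine List.map_congr_left fun i _ => ?_
    have e1 : m + 1 + i = m + (i + 1) := by omega
    have e2 : m + 1 + d = m + (d + 1) := by omega
    simp only [Function.comp, Nat.succ_eq_add_one, e1, e2, Nat.add_eq_zero_iff, one_ne_zero,
      and_false, if_false]
    rcases Nat.eq_zero_or_pos i with rfl | hi
    · simp
    · rw [if_neg hi.ne']

lemma continuous_of_forall_tendsto_prod [TopologicalSpace E] {ι : Type*} {l : Filter ι} [l.NeBot]
    {f : ι → E → ℝ} {g : E → ℝ}
    (h : ∀ x, Tendsto (fun p : ι × E => f p.1 p.2) (l ×ˢ 𝓝 x) (𝓝 (g x))) : Continuous g := by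
  refine continuous_iff_continuousAt.2 fun x => Metric.tendsto_nhds.2 fun ε hε => ?_
  have h1 := Metric.tendsto_nhds.1 (h x) (ε / 2) (half_pos hε)
  obtain ⟨pa, ha, pb, hb, hab⟩ := eventually_prod_iff.1 h1
  filter_upwards [hb] with y hy
  have hl : Tendsto (fun i => f i y) l (𝓝 (g y)) :=
    (h y).comp (tendsto_id.prodMk (tendsto_const_nhds (x := y)))
  have h2 : dist (g y) (g x) ≤ ε / 2 :=
    le_of_tendsto (hl.dist tendsto_const_nhds) (ha.mono fun i hi => (hab hi hy).le)
  linarith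

/-- Continuous convergence implies uniform convergence on compact sets. -/
lemma tendstoUniformlyOn_of_forall_tendsto_prod [TopologicalSpace E] {ι : Type*} {l : Filter ι}
    {f : ι → E → ℝ} {g : E → ℝ} (hg : Continuous g)
    (h : ∀ x, Tendsto (fun p : ι × E => f p.1 p.2) (l ×ˢ 𝓝 x) (𝓝 (g x)))
    {K : Set E} (hK : IsCompact K) : TendstoUniformlyOn f g l K := by
  rw [← tendstoLocallyUniformlyOn_iff_tendstoUniformlyOn_of_compact hK,
    tendstoLocallyUniformlyOn_iff_forall_tendsto]
  intro x _
  have hx : Tendsto (fun p : ι × E => (g p.2, f p.1 p.2)) (l ×ˢ 𝓝 x) (𝓝 (g x, g x)) :=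
    ((hg.tendsto x).comp tendsto_snd).prodMk_nhds (h x)
  exact (hx.mono_left (prod_mono_right _ nhdsWithin_le_nhds)).mono_right (nhds_le_uniformity _)

/-- Weak convergence of finite measures tested against a bounded, continuously convergent family
of functions. -/
lemma tendsto_integral_of_weak_of_tendsto_prod [MeasurableSpace E] [TopologicalSpace E]
    [BorelSpace E] [PolishSpace E] [LocallyCompactSpace E] {ι : Type*} {l : Filter ι}
    {μ : ι → Measure E} {ν : Measure E} (hμ : ∀ i, IsFiniteMeasure (μ i)) [IsFiniteMeasure ν]
    (hw : ∀ f : E → ℝ, Continuous f → (∃ M, ∀ x, |f x| ≤ M) →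
      Tendsto (fun i => ∫ x, f x ∂μ i) l (𝓝 (∫ x, f x ∂ν)))
    {f : ι → E → ℝ} {g : E → ℝ} (hf : ∀ i, Measurable (f i)) (hg : Continuous g) {M : ℝ}
    (hfM : ∀ i x, |f i x| ≤ M) (hgM : ∀ x, |g x| ≤ M)
    (h : ∀ x, Tendsto (fun p : ι × E => f p.1 p.2) (l ×ˢ 𝓝 x) (𝓝 (g x))) :
    Tendsto (fun i => ∫ x, f i x ∂μ i) l (𝓝 (∫ x, g x ∂ν)) := by
  rcases isEmpty_or_nonempty E with hE | ⟨⟨x₀⟩⟩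
  · simpa [integral_of_isEmpty] using tendsto_const_nhds
  have hM0 : 0 ≤ M := (abs_nonneg _).trans (hgM x₀)
  have hint : ∀ i, Integrable (f i) (μ i) := fun i =>
    .of_bound (hf i).aestronglyMeasurable M (.of_forall (hfM i))
  have hgint : ∀ i, Integrable g (μ i) := fun i =>
    .of_bound hg.measurable.aestronglyMeasurable M (.of_forall hgM)
  have hdiff : Tendsto (fun i => (∫ x, f i x ∂μ i) - ∫ x, g x ∂μ i) l (𝓝 0) := by
    refine Metric.tendsto_nhds.2 fun δ hδ => ?_
    set C := ν.real univ + 2 * M + 1 with hC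
    have hC0 : 0 < C := by positivity
    set ε := δ / (2 * C) with hεdef
    have hε : 0 < ε := by positivity
    obtain ⟨K, -, hK, hKν⟩ := MeasurableSet.univ.exists_isCompact_lt_add (μ := ν)
      (measure_ne_top _ _) (ENNReal.ofReal_pos.2 hε).ne'
    have hKc : ν.real Kᶜ ≤ ε := by
      refine ENNReal.toReal_le_of_le_ofReal hε.le ?_
      rw [measure_compl hK.measurableSet (measure_ne_top _ _)]
      exact tsub_le_iff_left.2 hKν.le
    obtain ⟨χ, hχ1, -, hχc, hχ01⟩ := exists_continuous_one_zero_of_isCompact hK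
      isClosed_empty (disjoint_empty K)
    set ψ : E → ℝ := fun x => ε + 2 * M * (1 - χ x) with hψ
    have hψc : Continuous ψ := by fun_prop
    have hψb : ∀ x, |ψ x| ≤ ε + 2 * M := fun x => by
      have := hχ01 x
      rw [abs_of_nonneg (by have := this.2; have : 0 ≤ 1 - χ x := by linarith
                            positivity)]
      simp only [hψ]
      nlinarith [this.1]
    have hψint : ∀ i, Integrable ψ (μ i) := fun i =>
      .of_bound hψc.measurable.aestronglyMeasurable _ (.of_forall hψb)
    have hψν : ∫ x, ψ x ∂ν < δ := by
      have h1 : ∫ x, ψ x ∂ν ≤ ∫ x, ε + Kᶜ.indicator (fun _ => 2 * M) x ∂ν := by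
        refine integral_mono (.of_bound hψc.measurable.aestronglyMeasurable _ (.of_forall hψb))
          ((integrable_const _).add ((integrable_const _).indicator hK.measurableSet.compl))
          fun x => ?_
        by_cases hx : x ∈ K
        · simp [hψ, hx, hχ1 hx]
        · have := (hχ01 x).1
          simp only [hψ, indicator_of_mem (mem_compl hx)]
          nlinarith
      rw [integral_add (g := Kᶜ.indicator fun _ => 2 * M) (integrable_const _)
        ((integrable_const _).indicator hK.measurableSet.compl), integral_indicator
        hK.measurableSet.compl, setIntegral_const, integral_const, smul_eq_mul, smul_eq_mul] at h1
      have h2 : ν.real Kᶜ * (2 * M) ≤ ε * (2 * M) := by gcongr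
      have h3 : ε * C = δ / 2 := by rw [hεdef]; field_simp
      nlinarith
    have hev1 := (hw ψ hψc ⟨_, hψb⟩).eventually_lt_const hψν
    have hev2 := Metric.tendstoUniformlyOn_iff.1
      (tendstoUniformlyOn_of_forall_tendsto_prod hg h hχc) ε hε
    filter_upwards [hev1, hev2] with i hi1 hi2
    rw [dist_zero_right, ← integral_sub (hint i) (hgint i)]
    refine lt_of_le_of_lt (norm_integral_le_of_norm_le (hψint i) (.of_forall fun x => ?_)) hi1
    rw [Real.norm_eq_abs]
    by_cases hx : x ∈ tsupport χ
    · have h1 := hi2 x hx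
      rw [dist_comm, Real.dist_eq] at h1
      have : 0 ≤ 2 * M * (1 - χ x) := mul_nonneg (by positivity) (by linarith [(hχ01 x).2])
      simp only [hψ]
      linarith
    · have h1 : χ x = 0 := image_eq_zero_of_notMem_tsupport hx
      simp only [hψ, h1]
      linarith [abs_sub (f i x) (g x), hfM i x, hgM x]
  simpa using hdiff.add (hw g hg ⟨M, hgM⟩)

lemma eventually_abs_le_add_one [TopologicalSpace E] {W : E → ℝ} (hW : Continuous W) (x : E) :
    ∀ᶠ p : ℕ × E in atTop ×ˢ 𝓝 x, |W p.2| ≤ |W x| + 1 :=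
  tendsto_snd.eventually ((hW.abs.continuousAt.eventually_lt continuousAt_const
    (by simp : |W x| < |W x| + 1)).mono fun _ h => h.le)

/-- Convergence of a sequence of bounded rates: at each time in `[0,u]` the measures converge
weakly, continuously in the state. -/
def RateTendsto [MeasurableSpace E] [TopologicalSpace E] (R : ℕ → ℝ → E → Measure E)
    (Q : ℝ → E → Measure E) (u : ℝ) : Prop :=
  ∀ τ ∈ Icc 0 u, ∀ f : E → ℝ, Continuous f → (∃ M, ∀ x, |f x| ≤ M) → ∀ x,
    Tendsto (fun p : ℕ × E => ∫ y, f y ∂(R p.1 τ p.2)) (atTop ×ˢ 𝓝 x) (𝓝 (∫ y, f y ∂Q τ x))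

section Convergence

variable [MeasurableSpace E] [TopologicalSpace E] {R : ℕ → ℝ → E → Measure E}
  {Q : ℝ → E → Measure E} {W : E → ℝ} {u : ℝ}

lemma tendsto_survival [FirstCountableTopology E] (hW : Continuous W)
    (hR : ∀ n, IsBoundedRate (R n) W) (hRQ : RateTendsto R Q u) {s r : ℝ} (hs : 0 ≤ s)
    (hsr : s ≤ r) (hr : r ≤ u) (x : E) :
    Tendsto (fun p : ℕ × E => survival (R p.1) p.2 s r) (atTop ×ˢ 𝓝 x)
      (𝓝 (survival Q x s r)) := by
  refine (Real.continuous_exp.tendsto _).comp (Tendsto.neg ?_)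
  refine intervalIntegral.tendsto_integral_filter_of_dominated_convergence (fun _ => |W x| + 1)
    (.of_forall fun p => ((hR p.1).measurable_qIntensity_left p.2).aestronglyMeasurable) ?_
    intervalIntegrable_const (.of_forall fun τ hτ => ?_)
  · filter_upwards [eventually_abs_le_add_one hW x] with p hp
    refine .of_forall fun τ _ => ?_
    rw [Real.norm_of_nonneg (qIntensity_nonneg _ _ _)]
    exact ((hR p.1).qIntensity_le τ p.2).trans hp
  · rw [uIoc_of_le hsr] at hτ
    have := hRQ τ ⟨hs.trans hτ.1.le, hτ.2.trans hr⟩ (fun _ => 1) continuous_const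
      ⟨1, fun _ => by simp⟩ x
    simpa [qIntensity, Measure.real] using this

lemma tendsto_integral_Piter [BorelSpace E] [PolishSpace E] [LocallyCompactSpace E]
    (hW : Continuous W) (hR : ∀ n, IsBoundedRate (R n) W) (hQ : IsBoundedRate Q W)
    (hRQ : RateTendsto R Q u) {F : E → ℝ} (hF : Continuous F) {M : ℝ} (hM : ∀ y, |F y| ≤ M)
    (k : ℕ) {s : ℝ} (hs : s ∈ Icc 0 u) (x : E) :
    Tendsto (fun p : ℕ × E => ∫ y, F y ∂Piter (R p.1) k s u p.2) (atTop ×ˢ 𝓝 x)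
      (𝓝 (∫ y, F y ∂Piter Q k s u x)) := by
  induction k generalizing s x with
  | zero =>
    simp only [IsBoundedRate.integral_Piter_zero _ _ _ hF.measurable]
    exact (tendsto_survival hW hR hRQ hs.1 hs.2 le_rfl x).mul
      ((hF.tendsto x).comp tendsto_snd)
  | succ k ih =>
    have hM0 : 0 ≤ M := (abs_nonneg _).trans (hM x)
    have e : ∀ p : ℕ × E, ∫ y, F y ∂Piter (R p.1) (k + 1) s u p.2 = ∫ r in Ioc s u,
        survival (R p.1) p.2 s r * ∫ y, ∫ z, F z ∂Piter (R p.1) k r u y ∂(R p.1 r p.2) := fun p =>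
      (hR p.1).integral_Piter_succ k s u p.2 hF.measurable hM
    rw [funext e, hQ.integral_Piter_succ k s u x hF.measurable hM]
    refine tendsto_integral_filter_of_dominated_convergence (fun _ => M * (|W x| + 1))
      (.of_forall fun p => ?_) ?_ (integrable_const _) ?_
    · refine Measurable.aestronglyMeasurable ?_
      exact ((hR p.1).measurable_survival_right p.2 s).mul
        ((hR p.1).measurable_integral_rate_left
          (g := fun r y => ∫ z, F z ∂Piter (R p.1) k r u y)
          ((hR p.1).measurable_integral_Piter k u hF.measurable) p.2)
    · filter_upwards [eventually_abs_le_add_one hW x] with p hp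
      refine (ae_restrict_iff' measurableSet_Ioc).2 (.of_forall fun r hr => ?_)
      have := (hR p.1).isFiniteMeasure r p.2
      rw [norm_mul, Real.norm_of_nonneg (survival_pos _ _ _ _).le]
      refine (mul_le_of_le_one_left (norm_nonneg _) (survival_le_one _ _ hr.1.le)).trans ?_
      refine (norm_integral_le_of_norm_le_const (C := M) (.of_forall fun y =>
        (hR p.1).abs_integral_Piter_le k hr.2 y hM)).trans ?_
      gcongr
      exact ((hR p.1).qIntensity_le r p.2).trans hp
    · refine (ae_restrict_iff' measurableSet_Ioc).2 (.of_forall fun r hr => ?_)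
      have hr' : r ∈ Icc 0 u := ⟨hs.1.trans hr.1.le, hr.2⟩
      have := hQ.isFiniteMeasure r x
      refine (tendsto_survival hW hR hRQ hs.1 hr.1.le hr.2 x).mul ?_
      refine tendsto_integral_of_weak_of_tendsto_prod
        (f := fun (p : ℕ × E) y => ∫ z, F z ∂Piter (R p.1) k r u y)
        (g := fun y => ∫ z, F z ∂Piter Q k r u y)
        (fun p => (hR p.1).isFiniteMeasure r p.2) (fun f hf hfb => hRQ r hr' f hf hfb x)
        (fun p => ?_) ?_ (fun p y => (hR p.1).abs_integral_Piter_le k hr.2 y hM)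
        (fun y => hQ.abs_integral_Piter_le k hr.2 y hM) fun y => ?_
      · have := ((hR p.1).measurable_integral_Piter k u hF.measurable).comp
          (measurable_prodMk_left (x := r))
        exact this
      · exact continuous_of_forall_tendsto_prod (l := atTop)
          (f := fun n y => ∫ z, F z ∂Piter (R n) k r u y) fun y => ih hr' y
      · have hp : Tendsto (fun q : (ℕ × E) × E => (q.1.1, q.2)) ((atTop ×ˢ 𝓝 x) ×ˢ 𝓝 y)
            (atTop ×ˢ 𝓝 y) := (tendsto_fst.comp tendsto_fst).prodMk tendsto_snd
        exact (ih hr' y).comp hp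

/-- Convergence of rates implies convergence of the regularized evolutions, uniformly on compact
sets. -/
lemma tendstoUniformlyOn_Ualpha [BorelSpace E] [PolishSpace E] [LocallyCompactSpace E]
    (hW : Continuous W) (hR : ∀ n, IsBoundedRate (R n) W) (hQ : IsBoundedRate Q W)
    (hRQ : RateTendsto R Q u) {α : ℝ} (hα : α ∈ Ioo (0 : ℝ) 1) {F : E → ℝ} (hF : Continuous F)
    {M : ℝ} (hM : ∀ y, |F y| ≤ M) {s : ℝ} (hs : s ∈ Icc 0 u) {K : Set E} (hK : IsCompact K) :
    TendstoUniformlyOn (fun n => Ualpha (R n) α s u F) (Ualpha Q α s u F) atTop K := by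
  have h : ∀ x, Tendsto (fun p : ℕ × E => Ualpha (R p.1) α s u F p.2) (atTop ×ˢ 𝓝 x)
      (𝓝 (Ualpha Q α s u F x)) := fun x => by
    refine tendsto_tsum_of_dominated_convergence
      ((summable_geometric_of_lt_one hα.1.le hα.2).mul_right M)
      (fun k => (tendsto_integral_Piter hW hR hQ hRQ hF hM k hs x).const_mul _)
      (.of_forall fun p k => ?_)
    rw [norm_mul, norm_pow, Real.norm_of_nonneg hα.1.le]
    gcongr
    · exact pow_nonneg hα.1.le k
    · exact (hR p.1).abs_integral_Piter_le k hs.2 p.2 hM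
  exact tendstoUniformlyOn_of_forall_tendsto_prod
    (continuous_of_forall_tendsto_prod (f := fun n => Ualpha (R n) α s u F) h) h hK

end Convergence

/-- Chernoff product formula.  For piecewise constant (in time)
discretizations `Q_n` of `Q` along partitions with vanishing mesh, the regularized
evolution `U_{α,n}(s,t)` is the finite product
`T_{α,t_{m₀}}(t_{m₀+1} − s) ⋯ T_{α,t_{m₁}}(t − t_{m₁})` of regularized semigroups, and
`U_{α,n}(s,t)F → U_α(s,t)F` uniformly on compacts. -/
theorem chernoff_product_formula [MeasurableSpace E] [TopologicalSpace E] [BorelSpace E]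
    [PolishSpace E] [LocallyCompactSpace E]
    (Q : ℝ → E → Measure E) (V : E → ℝ) (c : ℝ → ℝ)
    (hQ : IsTransitionFunction Q) (hH : StandingHypotheses Q V c)
    (α : ℝ) (hα : α ∈ Ioo (0 : ℝ) 1)
    (t : ℕ → ℕ → ℝ) (ht0 : ∀ n, t n 0 = 0) (htmono : ∀ n, StrictMono (t n))
    (httop : ∀ n, Filter.Tendsto (t n) Filter.atTop Filter.atTop)
    (hmesh : ∀ ε > (0 : ℝ), ∃ N : ℕ, ∀ n ≥ N, ∀ k : ℕ, t n (k + 1) - t n k < ε)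
    (Qn : ℕ → ℝ → E → Measure E)
    (hQn : ∀ n k (r : ℝ) (x : E), t n k ≤ r → r < t n (k + 1) → Qn n r x = Q (t n k) x)
    (s u : ℝ) (hs : 0 ≤ s) (hsu : s ≤ u)
    (F : E → ℝ) (hFc : Continuous F) (hFb : ∃ M : ℝ, ∀ x, |F x| ≤ M) :
    (∀ n m₀ m₁ : ℕ, m₀ ≤ m₁ →
      t n m₀ ≤ s → s < t n (m₀ + 1) → t n m₁ ≤ u → u < t n (m₁ + 1) →
      ∀ x : E,
        Ualpha (Qn n) α s u F x =
          ((List.range (m₁ - m₀ + 1)).map fun i =>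
              (t n (m₀ + i),
                (if m₀ + i = m₁ then u else t n (m₀ + i + 1)) -
                  (if i = 0 then s else t n (m₀ + i)))).foldr
            (fun pr G => Talpha Q α pr.1 pr.2 G) F x) ∧
    (∀ K : Set E, IsCompact K →
      TendstoUniformlyOn (fun n x => Ualpha (Qn n) α s u F x)
        (fun x => Ualpha Q α s u F x) Filter.atTop K) := by
  obtain ⟨M, hM⟩ := hFb
  have hu : 0 ≤ u := hs.trans hsu
  obtain ⟨a, -, haV⟩ := hH.q_bound (u + 1) (by linarith)
  have hmem : ∀ {r}, 0 ≤ r → r ≤ u → r ∈ Icc 0 (u + 1) := fun h0 h1 => ⟨h0, by linarith⟩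
  have hQ' := isBoundedRate_truncatedRate (W := fun x => a * V x) hQ haV
  have hW : Continuous fun x => a * V x := hH.V_cont.const_mul a
  choose φ hφm hφ using fun n => exists_measurable_leftEndpoint (ht0 n) (htmono n) (httop n)
  set R : ℕ → ℝ → E → Measure E := fun n r => truncatedRate Q (u + 1) (φ n r) with hRdef
  have hR : ∀ n, IsBoundedRate (R n) fun x => a * V x := fun n => hQ'.comp (hφm n)
  have ht : ∀ n k, 0 ≤ t n k := fun n k => ht0 n ▸ (htmono n).monotone k.zero_le
  have hRQn : ∀ n r, 0 ≤ r → r ≤ u → ∀ x, Qn n r x = R n r x := fun n r h0 h1 x => by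
    obtain ⟨k, hk, hkr, hrk⟩ := hφ n r h0
    rw [hQn n k r x hkr hrk, hRdef]
    dsimp only
    rw [hk, truncatedRate_of_mem (hmem (ht n k) (hkr.trans h1))]
  have hU : ∀ n, Ualpha (Qn n) α s u F = Ualpha (R n) α s u F := fun n =>
    Ualpha_congr α hsu (fun r hr => hRQn n r (hs.trans hr.1.le) hr.2.le) F
  refine ⟨fun n m₀ m₁ hm h1 h2 h3 h4 x => ?_, fun K hK => ?_⟩
  · obtain ⟨d, rfl⟩ := Nat.exists_eq_add_of_le hm
    rw [hU, Nat.add_sub_cancel_left]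
    refine congrFun (Ualpha_eq_foldr_Talpha (hR n) hα (htmono n) (fun k hk => ?_)
      (fun k r y hkr hrk hru => ?_) hFc.measurable hM d h1 h2.le hsu h3 h4.le) x
    · have := hQ'.comp (measurable_const (a := t n k))
      rwa [truncatedRate_of_mem (hmem (ht n k) hk)] at this
    · rw [← hRQn n r ((ht n k).trans hkr) hru, hQn n k r y hkr hrk]
  · have hconv : RateTendsto R (truncatedRate Q (u + 1)) u := by
      intro τ hτ f hf ⟨C, hC⟩ x
      have hφτ : Tendsto (fun n => φ n τ) atTop (𝓝 τ) := by
        refine Metric.tendsto_atTop.2 fun ε hε => ?_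
        obtain ⟨N, hN⟩ := hmesh ε hε
        refine ⟨N, fun n hn => ?_⟩
        obtain ⟨k, hk, hkr, hrk⟩ := hφ n τ hτ.1
        rw [hk, Real.dist_eq, abs_sub_comm, abs_of_nonneg (sub_nonneg.2 hkr)]
        linarith [hN n hn k]
      have hφmem : ∀ n, 0 ≤ φ n τ ∧ φ n τ ≤ u := fun n => by
        obtain ⟨k, hk, hkr, -⟩ := hφ n τ hτ.1
        exact hk ▸ ⟨ht n k, hkr.trans hτ.2⟩
      have hcont := hH.weak_cont f hf ⟨C, fun y => (hC y).trans
        (le_mul_of_one_le_right ((abs_nonneg _).trans (hC y)) (by linarith [hH.V_nonneg y]))⟩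
        (τ, x) hτ.1
      have hp : Tendsto (fun p : ℕ × E => (φ p.1 τ, p.2)) (atTop ×ˢ 𝓝 x)
          (𝓝[{p : ℝ × E | 0 ≤ p.1}] (τ, x)) :=
        tendsto_nhdsWithin_iff.2 ⟨(hφτ.comp tendsto_fst).prodMk_nhds tendsto_snd,
          .of_forall fun p => (hφmem p.1).1⟩
      have := Tendsto.comp hcont hp
      rw [truncatedRate_of_mem (hmem hτ.1 hτ.2)]
      refine this.congr fun p => ?_
      simp only [hRdef, Function.comp, truncatedRate_of_mem (hmem (hφmem p.1).1 (hφmem p.1).2)]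
    have hlim : Ualpha Q α s u F = Ualpha (truncatedRate Q (u + 1)) α s u F :=
      Ualpha_congr α hsu (fun r hr y =>
        (congrFun (truncatedRate_of_mem (hmem (hs.trans hr.1.le) hr.2.le)) y).symm) F
    simp only [hU, hlim]
    exact tendstoUniformlyOn_Ualpha hW hR hQ' hconv hα hFc hM ⟨hs, hsu⟩ hK
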